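/- Let W be a discrete memoryless channel with finite input alphabet X and finite output alphabet Y such that every output is accessible. Then there exist μ > 0, η > 0 and q_min > 0 such that for every P ∈ Π_μ and every Q ∈ Γ_μ^η: (1) Q(y) > q_min for all y ∈ Y; (2) V(W‖Q|P) ≥ V_min/2; and (3) D(W‖Q|P) ≤ I(P,W) + ‖Q − PW‖₂²/q_min. -/

import Mathlib

open Finset MeasureTheory

/-- `P` is a probability distribution on the finite set `Z`. -/
def IsDist {Z : Type*} [Fintype Z] (P : Z → ℝ) : Prop :=
  (∀ z, 0 ≤ P z) ∧ ∑ z, P z = 1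

/-- `W` is a (discrete memoryless) channel from `X` to `Y`: a stochastic matrix. -/
def IsChannel {X Y : Type*} [Fintype X] [Fintype Y] (W : X → Y → ℝ) : Prop :=
  ∀ x, IsDist (W x)

/-- Relative entropy `D(P‖Q) = Σ_z P(z) log (P(z)/Q(z))`. -/
noncomputable def relEnt {Z : Type*} [Fintype Z] (P Q : Z → ℝ) : ℝ :=
  ∑ z, P z * Real.log (P z / Q z)

/-- Divergence variance `V(P‖Q)`. -/
noncomputable def divVar {Z : Type*} [Fintype Z] (P Q : Z → ℝ) : ℝ :=
  ∑ z, P z * (Real.log (P z / Q z) - relEnt P Q) ^ 2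

/-- Output distribution `PW`. -/
noncomputable def outDist {X Y : Type*} [Fintype X] (P : X → ℝ) (W : X → Y → ℝ) (y : Y) : ℝ :=
  ∑ x, P x * W x y

/-- Mutual information `I(P,W) = Σ_x P(x) D(W(·|x)‖PW)`. -/
noncomputable def mutInfo {X Y : Type*} [Fintype X] [Fintype Y] (P : X → ℝ) (W : X → Y → ℝ) : ℝ :=
  ∑ x, P x * relEnt (W x) (outDist P W)

/-- Channel capacity `C = max_P I(P,W)`. -/
noncomputable def capacity {X Y : Type*} [Fintype X] [Fintype Y] (W : X → Y → ℝ) : ℝ :=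
  sSup {c : ℝ | ∃ P : X → ℝ, IsDist P ∧ c = mutInfo P W}

/-- `P` is a capacity-achieving input distribution (member of `Π`). -/
def isCAID {X Y : Type*} [Fintype X] [Fintype Y] (W : X → Y → ℝ) (P : X → ℝ) : Prop :=
  IsDist P ∧ mutInfo P W = capacity W

/-- Conditional information variance `V(P,W) = Σ_x P(x) V(W(·|x)‖PW)`. -/
noncomputable def infoVar {X Y : Type*} [Fintype X] [Fintype Y] (P : X → ℝ) (W : X → Y → ℝ) : ℝ :=
  ∑ x, P x * divVar (W x) (outDist P W)

/-- `V_min = min_{P ∈ Π} V(P,W)`. -/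
noncomputable def Vmin {X Y : Type*} [Fintype X] [Fintype Y] (W : X → Y → ℝ) : ℝ :=
  sInf {v : ℝ | ∃ P : X → ℝ, isCAID W P ∧ v = infoVar P W}

/-- `V_max = max_{P ∈ Π} V(P,W)`. -/
noncomputable def Vmax {X Y : Type*} [Fintype X] [Fintype Y] (W : X → Y → ℝ) : ℝ :=
  sSup {v : ℝ | ∃ P : X → ℝ, isCAID W P ∧ v = infoVar P W}

/-- The `ε`-channel dispersion `V_ε`. -/
noncomputable def Veps {X Y : Type*} [Fintype X] [Fintype Y] (W : X → Y → ℝ) (ε : ℝ) : ℝ :=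
  if ε < 1/2 then Vmin W else Vmax W

/-- Euclidean norm of the difference of two functions on a finite set. -/
noncomputable def dist2 {Z : Type*} [Fintype Z] (P Q : Z → ℝ) : ℝ :=
  Real.sqrt (∑ z, (P z - Q z) ^ 2)

/-- Conditional information divergence `D(W‖Q|P) = Σ_x P(x) D(W(·|x)‖Q)`. -/
noncomputable def condRelEnt {X Y : Type*} [Fintype X] [Fintype Y]
    (W : X → Y → ℝ) (Q : Y → ℝ) (P : X → ℝ) : ℝ :=
  ∑ x, P x * relEnt (W x) Q

/-- Conditional divergence variance `V(W‖Q|P) = Σ_x P(x) V(W(·|x)‖Q)`. -/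
noncomputable def condDivVar {X Y : Type*} [Fintype X] [Fintype Y]
    (W : X → Y → ℝ) (Q : Y → ℝ) (P : X → ℝ) : ℝ :=
  ∑ x, P x * divVar (W x) Q

/-- Cross-entropy decomposition of the conditional information divergence. -/
theorem condRelEnt_eq_sub {X Y : Type*} [Fintype X] [Fintype Y] {W : X → Y → ℝ}
    {P : X → ℝ} {Q : Y → ℝ} (hQ : ∀ x y, P x * W x y ≠ 0 → Q y ≠ 0) :
    condRelEnt W Q P = ∑ x, P x * ∑ y, W x y * Real.log (W x y)
      - ∑ y, outDist P W y * Real.log (Q y) := by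
  have hswap : ∑ y, outDist P W y * Real.log (Q y)
      = ∑ x, ∑ y, P x * W x y * Real.log (Q y) := by
    simp only [outDist, Finset.sum_mul]
    exact Finset.sum_comm
  rw [hswap, ← Finset.sum_sub_distrib]
  refine Finset.sum_congr rfl fun x _ => ?_
  rw [relEnt, Finset.mul_sum, Finset.mul_sum, ← Finset.sum_sub_distrib]
  refine Finset.sum_congr rfl fun y _ => ?_
  by_cases h : P x * W x y = 0
  · rcases mul_eq_zero.mp h with h | h <;> simp [h]
  · rw [Real.log_div (right_ne_zero_of_mul h) (hQ x y h)]
    ring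

theorem outDist_nonneg {X Y : Type*} [Fintype X] [Fintype Y] {W : X → Y → ℝ} {P : X → ℝ}
    (hW : IsChannel W) (hP : IsDist P) (y : Y) : 0 ≤ outDist P W y :=
  Finset.sum_nonneg fun x _ => mul_nonneg (hP.1 x) ((hW x).1 y)

theorem isDist_outDist {X Y : Type*} [Fintype X] [Fintype Y] {W : X → Y → ℝ} {P : X → ℝ}
    (hW : IsChannel W) (hP : IsDist P) : IsDist (outDist P W) := by
  refine ⟨outDist_nonneg hW hP, ?_⟩
  simp only [outDist]
  rw [Finset.sum_comm]
  simp only [← Finset.mul_sum, (hW _).2, mul_one, hP.2]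

theorem continuous_outDist {X Y : Type*} [Fintype X] (W : X → Y → ℝ) :
    Continuous fun P : X → ℝ => outDist P W := by
  unfold outDist
  fun_prop

/-- Mutual information as output entropy minus conditional entropy. -/
theorem mutInfo_eq_sum_negMulLog {X Y : Type*} [Fintype X] [Fintype Y] {W : X → Y → ℝ}
    {P : X → ℝ} (hW : IsChannel W) (hP : IsDist P) :
    mutInfo P W = ∑ y, Real.negMulLog (outDist P W y)
      + ∑ x, P x * ∑ y, W x y * Real.log (W x y) := by
  have hne : ∀ x y, P x * W x y ≠ 0 → outDist P W y ≠ 0 := fun x y h h0 =>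
    h ((Finset.sum_eq_zero_iff_of_nonneg fun x _ => mul_nonneg (hP.1 x) ((hW x).1 y)).1 h0 x
      (Finset.mem_univ x))
  have h := condRelEnt_eq_sub hne
  rw [show mutInfo P W = condRelEnt W (outDist P W) P from rfl, h]
  simp only [Real.negMulLog, neg_mul, Finset.sum_neg_distrib]
  ring

theorem continuousOn_mutInfo {X Y : Type*} [Fintype X] [Fintype Y] {W : X → Y → ℝ}
    (hW : IsChannel W) : ContinuousOn (fun P => mutInfo P W) (stdSimplex ℝ X) := by
  have hc : Continuous fun P : X → ℝ => ∑ y, Real.negMulLog (outDist P W y)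
      + ∑ x, P x * ∑ y, W x y * Real.log (W x y) := by
    have h := continuous_outDist W
    have h' : ∀ y, Continuous fun P : X → ℝ => Real.negMulLog (outDist P W y) := fun y =>
      Real.continuous_negMulLog.comp ((continuous_apply y).comp h)
    fun_prop
  exact hc.continuousOn.congr fun P hP => mutInfo_eq_sum_negMulLog hW hP

theorem mutInfo_le_capacity {X Y : Type*} [Fintype X] [Fintype Y] {W : X → Y → ℝ}
    {P : X → ℝ} (hW : IsChannel W) (hP : IsDist P) : mutInfo P W ≤ capacity W := by
  refine le_csSup ?_ ⟨P, hP, rfl⟩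
  refine ((isCompact_stdSimplex ℝ X).bddAbove_image (continuousOn_mutInfo hW)).mono ?_
  rintro c ⟨P, hP, rfl⟩
  exact ⟨P, hP, rfl⟩

theorem isCompact_setOf_isCAID {X Y : Type*} [Fintype X] [Fintype Y] {W : X → Y → ℝ}
    (hW : IsChannel W) : IsCompact {P | isCAID W P} := by
  have h := (continuousOn_mutInfo hW).preimage_isClosed_of_isClosed
    (isClosed_stdSimplex ℝ X) (isClosed_singleton (x := capacity W))
  exact (isCompact_stdSimplex ℝ X).of_isClosed_subset h Set.inter_subset_left

theorem outDist_convexComb {X Y : Type*} [Fintype X] (W : X → Y → ℝ) (P R : X → ℝ)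
    (a b : ℝ) (y : Y) :
    outDist (fun x => a * P x + b * R x) W y = a * outDist P W y + b * outDist R W y := by
  simp only [outDist, Finset.mul_sum, ← Finset.sum_add_distrib]
  exact Finset.sum_congr rfl fun x _ => by ring

theorem IsDist.convexComb {X : Type*} [Fintype X] {P R : X → ℝ} (hP : IsDist P)
    (hR : IsDist R) {a b : ℝ} (ha : 0 ≤ a) (hb : 0 ≤ b) (hab : a + b = 1) :
    IsDist fun x => a * P x + b * R x := by
  refine ⟨fun x => add_nonneg (mul_nonneg ha (hP.1 x)) (mul_nonneg hb (hR.1 x)), ?_⟩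
  rw [Finset.sum_add_distrib, ← Finset.mul_sum, ← Finset.mul_sum, hP.2, hR.2]
  linarith

/-- The concavity gap of the mutual information is the concavity gap of the output entropy. -/
theorem mutInfo_convexComb {X Y : Type*} [Fintype X] [Fintype Y] {W : X → Y → ℝ}
    {P R : X → ℝ} (hW : IsChannel W) (hP : IsDist P) (hR : IsDist R) {a b : ℝ} (ha : 0 ≤ a)
    (hb : 0 ≤ b) (hab : a + b = 1) :
    mutInfo (fun x => a * P x + b * R x) W = a * mutInfo P W + b * mutInfo R W
      + ∑ y, (Real.negMulLog (a * outDist P W y + b * outDist R W y)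
        - (a * Real.negMulLog (outDist P W y) + b * Real.negMulLog (outDist R W y))) := by
  rw [mutInfo_eq_sum_negMulLog hW (hP.convexComb hR ha hb hab), mutInfo_eq_sum_negMulLog hW hP,
    mutInfo_eq_sum_negMulLog hW hR]
  simp only [outDist_convexComb, add_mul, Finset.sum_add_distrib, Finset.sum_sub_distrib,
    mul_assoc, ← Finset.mul_sum]
  ring

theorem negMulLog_convexComb_gap_nonneg {a b s t : ℝ} (ha : 0 ≤ a) (hb : 0 ≤ b)
    (hab : a + b = 1) (hs : 0 ≤ s) (ht : 0 ≤ t) :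
    0 ≤ Real.negMulLog (a * s + b * t) - (a * Real.negMulLog s + b * Real.negMulLog t) := by
  have h := Real.concaveOn_negMulLog.2 (Set.mem_Ici.2 hs) (Set.mem_Ici.2 ht) ha hb hab
  simp only [smul_eq_mul] at h
  linarith

/-- All capacity-achieving input distributions induce the same output distribution. -/
theorem isCAID.outDist_eq {X Y : Type*} [Fintype X] [Fintype Y] {W : X → Y → ℝ}
    {P R : X → ℝ} (hW : IsChannel W) (hP : isCAID W P) (hR : isCAID W R) :
    outDist P W = outDist R W := by
  funext y
  by_contra hne
  have hh : (0 : ℝ) < 1 / 2 := by norm_num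
  have hsum : (1 / 2 : ℝ) + 1 / 2 = 1 := by norm_num
  have hle := mutInfo_le_capacity hW (hP.1.convexComb hR.1 hh.le hh.le hsum)
  rw [mutInfo_convexComb hW hP.1 hR.1 hh.le hh.le hsum, hP.2, hR.2] at hle
  have hpos : 0 < ∑ y, (Real.negMulLog (1 / 2 * outDist P W y + 1 / 2 * outDist R W y)
        - (1 / 2 * Real.negMulLog (outDist P W y)
          + 1 / 2 * Real.negMulLog (outDist R W y))) := by
    refine Finset.sum_pos' (fun y _ => negMulLog_convexComb_gap_nonneg hh.le hh.le hsum
      (outDist_nonneg hW hP.1 y) (outDist_nonneg hW hR.1 y)) ⟨y, Finset.mem_univ y, ?_⟩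
    have h := Real.strictConcaveOn_negMulLog.2 (Set.mem_Ici.2 (outDist_nonneg hW hP.1 y))
      (Set.mem_Ici.2 (outDist_nonneg hW hR.1 y)) hne hh hh hsum
    simp only [smul_eq_mul] at h
    linarith
  linarith

/-- The output distribution of a capacity-achieving input charges every accessible output. -/
theorem isCAID.outDist_pos {X Y : Type*} [Fintype X] [Fintype Y] {W : X → Y → ℝ}
    {P : X → ℝ} (hW : IsChannel W) (hP : isCAID W P) {x : X} {y : Y} (hxy : 0 < W x y) :
    0 < outDist P W y := by
  classical
  refine lt_of_le_of_ne (outDist_nonneg hW hP.1 y) fun h0 => ?_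
  set R : X → ℝ := Pi.single x 1 with hRdef
  have hR : IsDist R := by
    refine ⟨fun z => ?_, by simp [hRdef]⟩
    by_cases hz : z = x
    · subst hz; simp [hRdef]
    · simp [hRdef, hz]
  have hRout : ∀ z, outDist R W z = W x z := fun z => by
    simp [outDist, hRdef, Pi.single_apply]
  have hRinfo : mutInfo R W = 0 := by
    rw [mutInfo_eq_sum_negMulLog hW hR]
    simp only [hRout]
    simp [hRdef, Pi.single_apply, Real.negMulLog]
  set c : ℝ := |capacity W| + 1
  have hcpos : 0 < c := by positivity
  set t : ℝ := Real.exp (-(c / W x y))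
  have ht0 : 0 < t := Real.exp_pos _
  have ht1 : t < 1 := Real.exp_lt_one_iff.2 (neg_lt_zero.2 (div_pos hcpos hxy))
  have hsum : (1 - t) + t = 1 := by ring
  have hle := mutInfo_le_capacity hW (hP.1.convexComb hR (by linarith) ht0.le hsum)
  rw [mutInfo_convexComb hW hP.1 hR (by linarith) ht0.le hsum, hP.2, hRinfo] at hle
  have hgap : t * c ≤ ∑ z, (Real.negMulLog ((1 - t) * outDist P W z + t * outDist R W z)
        - ((1 - t) * Real.negMulLog (outDist P W z) + t * Real.negMulLog (outDist R W z))) := by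
    refine le_trans (le_of_eq ?_) (Finset.single_le_sum (fun z _ =>
      negMulLog_convexComb_gap_nonneg (by linarith) ht0.le hsum
      (outDist_nonneg hW hP.1 z) (outDist_nonneg hW hR z)) (Finset.mem_univ y))
    rw [← h0, hRout, Real.negMulLog_zero, mul_zero, zero_add, zero_add,
      Real.negMulLog_mul]
    have hlog : Real.log t = -(c / W x y) := Real.log_exp _
    rw [Real.negMulLog, hlog]
    field_simp
    ring
  have hlt : capacity W < c := lt_of_le_of_lt (le_abs_self _) (by linarith)
  have := mul_lt_mul_of_pos_left hlt ht0
  linarith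

theorem divVar_nonneg {Z : Type*} [Fintype Z] {P : Z → ℝ} (hP : IsDist P) (Q : Z → ℝ) :
    0 ≤ divVar P Q :=
  Finset.sum_nonneg fun z _ => mul_nonneg (hP.1 z) (sq_nonneg _)

theorem condDivVar_nonneg {X Y : Type*} [Fintype X] [Fintype Y] {W : X → Y → ℝ}
    {P : X → ℝ} (hW : IsChannel W) (hP : IsDist P) (Q : Y → ℝ) : 0 ≤ condDivVar W Q P :=
  Finset.sum_nonneg fun x _ => mul_nonneg (hP.1 x) (divVar_nonneg (hW x) Q)

theorem Vmin_le_infoVar {X Y : Type*} [Fintype X] [Fintype Y] {W : X → Y → ℝ}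
    {P : X → ℝ} (hW : IsChannel W) (hP : isCAID W P) : Vmin W ≤ infoVar P W := by
  refine csInf_le ⟨0, ?_⟩ ⟨P, hP, rfl⟩
  rintro v ⟨R, hR, rfl⟩
  exact condDivVar_nonneg hW hR.1 _

theorem continuousAt_log_div {Z : Type*} (P : Z → ℝ) {Q : Z → ℝ} (hQ : ∀ z, 0 < Q z)
    {z : Z} (hz : P z ≠ 0) : ContinuousAt (fun Q : Z → ℝ => Real.log (P z / Q z)) Q :=
  ContinuousAt.log (continuousAt_const.div (continuous_apply z).continuousAt (hQ z).ne')
    (div_ne_zero hz (hQ z).ne')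

theorem continuousAt_relEnt {Z : Type*} [Fintype Z] (P : Z → ℝ) {Q : Z → ℝ}
    (hQ : ∀ z, 0 < Q z) : ContinuousAt (relEnt P) Q := by
  refine tendsto_finsetSum _ fun z _ => ?_
  by_cases hz : P z = 0
  · simp [hz]
  · exact (continuousAt_log_div P hQ hz).const_mul (P z)

theorem continuousAt_divVar {Z : Type*} [Fintype Z] (P : Z → ℝ) {Q : Z → ℝ}
    (hQ : ∀ z, 0 < Q z) : ContinuousAt (divVar P) Q := by
  refine tendsto_finsetSum _ fun z _ => ?_
  by_cases hz : P z = 0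
  · simp [hz]
  · exact (((continuousAt_log_div P hQ hz).sub (continuousAt_relEnt P hQ)).pow 2).const_mul (P z)

theorem continuousAt_condDivVar {X Y : Type*} [Fintype X] [Fintype Y] (W : X → Y → ℝ)
    (P : X → ℝ) {Q : Y → ℝ} (hQ : ∀ y, 0 < Q y) :
    ContinuousAt (fun p : (X → ℝ) × (Y → ℝ) => condDivVar W p.2 p.1) (P, Q) := by
  refine tendsto_finsetSum _ fun x _ => ?_
  have h1 : ContinuousAt (fun p : (X → ℝ) × (Y → ℝ) => p.1 x) (P, Q) := by fun_prop
  have h2 : ContinuousAt (fun p : (X → ℝ) × (Y → ℝ) => divVar (W x) p.2) (P, Q) :=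
    ContinuousAt.comp (f := Prod.snd) (continuousAt_divVar (W x) hQ) continuousAt_snd
  exact h1.mul h2

theorem dist_le_dist2 {Z : Type*} [Fintype Z] (P Q : Z → ℝ) : dist P Q ≤ dist2 P Q := by
  refine (dist_pi_le_iff (Real.sqrt_nonneg _)).2 fun z => ?_
  rw [Real.dist_eq]
  exact Real.abs_le_sqrt (Finset.single_le_sum (f := fun z => (P z - Q z) ^ 2)
    (fun z _ => sq_nonneg _) (Finset.mem_univ z))

theorem dist_outDist_le {X Y : Type*} [Fintype X] [Fintype Y] {W : X → Y → ℝ}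
    (hW : IsChannel W) (P R : X → ℝ) :
    dist (outDist P W) (outDist R W) ≤ Fintype.card X * dist P R := by
  refine (dist_pi_le_iff (by positivity)).2 fun y => ?_
  rw [Real.dist_eq, outDist, outDist, ← Finset.sum_sub_distrib, ← nsmul_eq_mul]
  refine (Finset.abs_sum_le_sum_abs _ _).trans (Finset.sum_le_card_nsmul _ _ _ fun x _ => ?_)
  have hle : W x y ≤ 1 := by
    rw [← (hW x).2]
    exact Finset.single_le_sum (fun y _ => (hW x).1 y) (Finset.mem_univ y)
  rw [← sub_mul, abs_mul, abs_of_nonneg ((hW x).1 y)]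
  refine (mul_le_of_le_one_right (abs_nonneg _) hle).trans ?_
  rw [← Real.dist_eq]
  exact dist_le_pi_dist P R x

/-- The excess of `D(W‖Q|P)` over the mutual information is bounded by a χ²-type distance. -/
theorem condRelEnt_le_mutInfo_add {X Y : Type*} [Fintype X] [Fintype Y] {W : X → Y → ℝ}
    {P : X → ℝ} {Q : Y → ℝ} (hW : IsChannel W) (hP : IsDist P) (hQ : IsDist Q) {q : ℝ}
    (hq : 0 < q) (hqQ : ∀ y, q < Q y) :
    condRelEnt W Q P ≤ mutInfo P W + (dist2 Q (outDist P W)) ^ 2 / q := by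
  have hQpos : ∀ y, 0 < Q y := fun y => hq.trans (hqQ y)
  rw [condRelEnt_eq_sub fun _ y _ => (hQpos y).ne', mutInfo_eq_sum_negMulLog hW hP, dist2,
    Real.sq_sqrt (Finset.sum_nonneg fun _ _ => sq_nonneg _), Finset.sum_div]
  have hout := isDist_outDist hW hP
  have key : ∀ y, -Real.negMulLog (outDist P W y) - outDist P W y * Real.log (Q y)
      ≤ (Q y - outDist P W y) ^ 2 / q + (outDist P W y - Q y) := by
    intro y
    generalize hr : outDist P W y = r
    have hr0 : 0 ≤ r := hr ▸ hout.1 y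
    have h1 : -Real.negMulLog r - r * Real.log (Q y) ≤ r * (r / Q y - 1) := by
      rcases hr0.eq_or_lt with rfl | hrpos
      · simp
      · have := mul_le_mul_of_nonneg_left
          (Real.log_le_sub_one_of_pos (div_pos hrpos (hQpos y))) hr0
        rw [Real.log_div hrpos.ne' (hQpos y).ne'] at this
        rw [Real.negMulLog]
        linarith
    have h2 : r * (r / Q y - 1) = (Q y - r) ^ 2 / Q y + (r - Q y) := by
      have := (hQpos y).ne'
      field_simp
      ring
    have h3 : (Q y - r) ^ 2 / Q y ≤ (Q y - r) ^ 2 / q :=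
      div_le_div_of_nonneg_left (sq_nonneg _) hq (hqQ y).le
    linarith
  have hsum := Finset.sum_le_sum fun y (_ : y ∈ Finset.univ) => key y
  simp only [Finset.sum_sub_distrib, Finset.sum_add_distrib, Finset.sum_neg_distrib, hout.2,
    hQ.2] at hsum
  linarith

/-- For a DMC `W` with all outputs accessible there are `μ, η, q_min > 0`
such that for every `P ∈ Π_μ` and `Q ∈ Γ_μ^η`: (1) `Q(y) > q_min` for all `y`;
(2) `V(W‖Q|P) ≥ V_min/2`; (3) `D(W‖Q|P) ≤ I(P,W) + ‖Q - PW‖₂²/q_min`. -/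
theorem continuity_around_CAID
    {X Y : Type*} [Fintype X] [Fintype Y] [Nonempty X] [Nonempty Y]
    (W : X → Y → ℝ) (hW : IsChannel W) (hacc : ∀ y, ∃ x, 0 < W x y) :
    ∃ μ > (0 : ℝ), ∃ η > (0 : ℝ), ∃ qmin > (0 : ℝ),
      ∀ P : X → ℝ, IsDist P → (∃ P₀ : X → ℝ, isCAID W P₀ ∧ dist2 P P₀ ≤ μ) →
      ∀ Q : Y → ℝ, IsDist Q →
        (∃ P₁ : X → ℝ, IsDist P₁ ∧ (∃ P₂ : X → ℝ, isCAID W P₂ ∧ dist2 P₁ P₂ ≤ μ) ∧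
          dist2 (outDist P₁ W) Q ≤ η) →
        (∀ y, qmin < Q y) ∧
        Vmin W / 2 ≤ condDivVar W Q P ∧
        condRelEnt W Q P ≤ mutInfo P W + (dist2 Q (outDist P W)) ^ 2 / qmin := by
  rcases Set.eq_empty_or_nonempty {P | isCAID W P} with hemp | ⟨Pc, hPc⟩
  · refine ⟨1, one_pos, 1, one_pos, 1, one_pos, fun P _ ⟨P₀, hP₀, _⟩ => ?_⟩
    exact absurd hP₀ (Set.eq_empty_iff_forall_notMem.1 hemp P₀)
  set q := outDist Pc W with hqdef
  have hqpos : ∀ y, 0 < q y := fun y => (hacc y).elim fun x hx => hPc.outDist_pos hW hx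
  obtain ⟨y₀, hy₀⟩ := Finite.exists_min q
  have hK : IsCompact ({P | isCAID W P} ×ˢ {q}) :=
    (isCompact_setOf_isCAID hW).prod isCompact_singleton
  set S : Set ((X → ℝ) × (Y → ℝ)) :=
    {p | (∀ y, q y₀ / 2 < p.2 y) ∧ (0 < Vmin W → Vmin W / 2 < condDivVar W p.2 p.1)}
  have hSnhds : {P | isCAID W P} ×ˢ {q} ⊆ interior S := by
    rintro ⟨P, Q⟩ ⟨hP, hQ⟩
    obtain rfl : Q = q := hQ
    rw [mem_interior_iff_mem_nhds]
    refine Filter.Eventually.and (Filter.eventually_all.2 fun y => ?_) ?_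
    · have hc : ContinuousAt (fun p : (X → ℝ) × (Y → ℝ) => p.2 y) (P, q) := by fun_prop
      exact hc.eventually (lt_mem_nhds (by linarith [hqpos y₀, hy₀ y]))
    · by_cases hV : 0 < Vmin W
      · have hlt : Vmin W / 2 < condDivVar W q P := by
          have h := Vmin_le_infoVar hW hP
          rw [infoVar, hP.outDist_eq hW hPc] at h
          exact lt_of_lt_of_le (by linarith) h
        filter_upwards [(continuousAt_condDivVar W P hqpos).eventually (lt_mem_nhds hlt)]
          with p hp _ using hp
      · exact Filter.Eventually.of_forall fun p h => absurd h hV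
  obtain ⟨δ, hδ, hsub⟩ := hK.exists_thickening_subset_open isOpen_interior hSnhds
  have hcard : (0 : ℝ) < Fintype.card X := by exact_mod_cast Fintype.card_pos
  have hμ : 0 < min (δ / 2) (δ / (4 * Fintype.card X)) := by positivity
  refine ⟨_, hμ, δ / 4, by positivity, q y₀ / 2, half_pos (hqpos y₀), ?_⟩
  rintro P hP ⟨P₀, hP₀, hPP₀⟩ Q hQ ⟨P₁, -, ⟨P₂, hP₂, hP₁P₂⟩, hP₁Q⟩
  have hdP : dist P P₀ < δ := by
    linarith [dist_le_dist2 P P₀, min_le_left (δ / 2) (δ / (4 * Fintype.card X))]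
  have hdQ : dist Q q < δ := by
    have h1 : dist P₁ P₂ ≤ δ / (4 * Fintype.card X) :=
      (dist_le_dist2 P₁ P₂).trans (hP₁P₂.trans (min_le_right _ _))
    have h2 : (Fintype.card X : ℝ) * dist P₁ P₂ ≤ δ / 4 :=
      (mul_le_mul_of_nonneg_left h1 hcard.le).trans (le_of_eq (by field_simp))
    have h3 := dist_outDist_le hW P₁ P₂
    rw [hP₂.outDist_eq hW hPc, ← hqdef] at h3
    have h4 := dist_le_dist2 (outDist P₁ W) Q
    have h5 := dist_triangle_left Q q (outDist P₁ W)
    linarith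
  have hmem : (P, Q) ∈ S := interior_subset <| hsub <|
    Metric.mem_thickening_iff.2 ⟨(P₀, q), ⟨hP₀, rfl⟩, max_lt hdP hdQ⟩
  refine ⟨hmem.1, ?_, condRelEnt_le_mutInfo_add hW hP hQ (half_pos (hqpos y₀)) hmem.1⟩
  by_cases hV : 0 < Vmin W
  · exact (hmem.2 hV).le
  · exact le_trans (by linarith) (condDivVar_nonneg hW hP Q)
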